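/- Let E_1, …, E_m and F be infinite dimensional Banach spaces, where each E_i has cotype q_i > 2, and set q = max{q_i : i = 1, …, m}. Let 1 < r < q*, r ≤ a < ∞, and 1 ≤ s < ∞ satisfy 1/r − 1/a ≤ 1 − 1/s. Then every multiple (a,r)-summing m-linear operator T : E_1 × ⋯ × E_m → F is multiple (s,1)-summing. -/

import Mathlib

open scoped ENNReal NNReal BigOperators ZeroAtInfty

noncomputable section

/-- The `k`-th Rademacher function on `[0,1]`. -/
def Rademacher (k : ℕ) (t : ℝ) : ℝ := (-1 : ℝ) ^ ⌊(2 : ℝ) ^ (k + 1) * t⌋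

/-- A Banach space `E` has cotype `q` (for `2 ≤ q < ∞`). -/
def HasCotype (q : ℝ) (E : Type*) [NormedAddCommGroup E] [NormedSpace ℝ E] : Prop :=
  2 ≤ q ∧ ∃ C > 0, ∀ (n : ℕ) (x : Fin n → E),
    (∑ k : Fin n, ‖x k‖ ^ q) ^ (1 / q) ≤
      C * (∫ t in (0:ℝ)..(1:ℝ), ‖∑ k : Fin n, Rademacher k.1 t • x k‖ ^ 2) ^ ((1:ℝ) / 2)

/-- `cot E`, the infimum of the cotypes of `E` (`∞` if `E` has no finite cotype). -/
def cot (E : Type*) [NormedAddCommGroup E] [NormedSpace ℝ E] : ℝ≥0∞ :=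
  sInf {c : ℝ≥0∞ | ∃ q : ℝ, HasCotype q E ∧ c = ENNReal.ofReal q}

/-- Conjugate exponent in `ℝ≥0∞` : `p* = p/(p-1)`, with `1* = ∞` and `∞* = 1`. -/
def conjE (p : ℝ≥0∞) : ℝ≥0∞ := 1 + 1 / (p - 1)

/-- A sequence is weakly `p`-summable. -/
def WeaklySummable {E : Type*} [NormedAddCommGroup E] [NormedSpace ℝ E]
    (p : ℝ) (x : ℕ → E) : Prop :=
  ∀ φ : E →L[ℝ] ℝ, Summable fun j => |φ (x j)| ^ p

/-- `u : E → F` is absolutely `(q,p)`-summing. -/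
def AbsolutelySumming {E F : Type*} [NormedAddCommGroup E] [NormedSpace ℝ E]
    [NormedAddCommGroup F] [NormedSpace ℝ F] (q p : ℝ) (u : E →L[ℝ] F) : Prop :=
  ∀ x : ℕ → E, WeaklySummable p x → Summable fun j => ‖u (x j)‖ ^ q

/-- The weak `ℓ_p` norm of a sequence. -/
def weakNorm {E : Type*} [NormedAddCommGroup E] [NormedSpace ℝ E] (p : ℝ) (x : ℕ → E) : ℝ :=
  ⨆ φ : {φ : E →L[ℝ] ℝ // ‖φ‖ ≤ 1}, (∑' j, |φ.1 (x j)| ^ p) ^ (1 / p)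

/-- A continuous `m`-linear operator is multiple `(q,p)`-summing. -/
def MultipleSumming {m : ℕ} {E : Fin m → Type*} [∀ i, NormedAddCommGroup (E i)]
    [∀ i, NormedSpace ℝ (E i)] {F : Type*} [NormedAddCommGroup F] [NormedSpace ℝ F]
    (q p : ℝ) (T : ContinuousMultilinearMap ℝ E F) : Prop :=
  ∃ C > 0, ∀ x : (i : Fin m) → ℕ → E i, (∀ i, WeaklySummable p (x i)) →
    (Summable fun j : Fin m → ℕ => ‖T (fun i => x i (j i))‖ ^ q) ∧
    (∑' j : Fin m → ℕ, ‖T (fun i => x i (j i))‖ ^ q) ^ (1 / q) ≤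
      C * ∏ i, weakNorm p (x i)


lemma abs_rademacher (k : ℕ) (t : ℝ) : |Rademacher k t| = 1 := by
  simp [Rademacher, abs_zpow]

/-- In a space of cotype `q`, unconditional bounds on signed sums control the `ℓ_q` norm. -/
lemma HasCotype.exists_sum_le {q : ℝ} {E : Type*} [NormedAddCommGroup E] [NormedSpace ℝ E]
    (h : HasCotype q E) : ∃ C > 0, ∀ (n : ℕ) (x : Fin n → E) (R : ℝ), 0 ≤ R →
      (∀ e : Fin n → ℝ, (∀ k, |e k| ≤ 1) → ‖∑ k, e k • x k‖ ≤ R) →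
      ∑ k, ‖x k‖ ^ q ≤ (C * R) ^ q := by
  obtain ⟨hq, C, hC, H⟩ := h
  refine ⟨C, hC, fun n x R hR hx => ?_⟩
  have hint : ∫ t in (0:ℝ)..(1:ℝ), ‖∑ k : Fin n, Rademacher k.1 t • x k‖ ^ 2 ≤ R ^ 2 := by
    have := intervalIntegral.norm_integral_le_of_norm_le_const (a := (0 : ℝ)) (b := 1)
      (f := fun t => ‖∑ k : Fin n, Rademacher k.1 t • x k‖ ^ 2) (C := R ^ 2) (fun t _ => by
        rw [Real.norm_of_nonneg (by positivity)]
        exact pow_le_pow_left₀ (norm_nonneg _)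
          (hx (fun k => Rademacher k.1 t) fun k => (abs_rademacher _ _).le) 2)
    refine (le_abs_self _).trans ?_
    simpa using this
  have hnn : 0 ≤ ∫ t in (0:ℝ)..(1:ℝ), ‖∑ k : Fin n, Rademacher k.1 t • x k‖ ^ 2 :=
    intervalIntegral.integral_nonneg zero_le_one fun _ _ => by positivity
  have hsq : (∫ t in (0:ℝ)..(1:ℝ), ‖∑ k : Fin n, Rademacher k.1 t • x k‖ ^ 2) ^ ((1:ℝ) / 2)
      ≤ R := by
    rw [← Real.sqrt_eq_rpow]
    exact Real.sqrt_le_iff.2 ⟨hR, hint⟩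
  have hS : 0 ≤ ∑ k, ‖x k‖ ^ q := Finset.sum_nonneg fun _ _ => by positivity
  have h1 := (H n x).trans (mul_le_mul_of_nonneg_left hsq hC.le)
  have h2 := Real.rpow_le_rpow (by positivity) h1 (by linarith : 0 ≤ q)
  rwa [← Real.rpow_mul hS, one_div_mul_cancel (by linarith), Real.rpow_one] at h2

/-- Pisier's factorization theorem for operators from `ℓ_∞^n` into a space of cotype `q`. -/
lemma HasCotype.exists_dominating_weight {q : ℝ} {E : Type*} [NormedAddCommGroup E]
    [NormedSpace ℝ E] (h : HasCotype q E) :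
    ∃ L > 0, ∀ {ι : Type} [Fintype ι] [DecidableEq ι] (x : ι → E),
      (∀ f : ι → ℝ, (∀ j, |f j| ≤ 1) → ‖∑ j, f j • x j‖ ≤ 1) →
      ∃ ν : ι → ℝ, (∀ j, 0 < ν j) ∧ ∑ j, ν j ≤ 1 ∧
        ∀ (A : Finset ι) (f : ι → ℝ), (∀ j, |f j| ≤ 1) →
          ‖∑ j ∈ A, f j • x j‖ ^ q ≤ L ^ q * ∑ j ∈ A, ν j := by
  have hq : 2 ≤ q := h.1
  have hq0 : 0 < q := by linarith
  obtain ⟨C, hC, H⟩ := h.exists_sum_le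
  set K : ℝ := q * C ^ q + 1 with hK
  have hK0 : 0 < K := by positivity
  refine ⟨K ^ (1 / q), by positivity, ?_⟩
  intro ι _ _ x hx
  rw [← Real.rpow_mul hK0.le, one_div_mul_cancel hq0.ne', Real.rpow_one]
  let u : (ι → ℝ) → E := fun f => ∑ j, f j • x j
  let S : Set ℝ := {v | ∃ (n : ℕ) (f : Fin n → ι → ℝ), (∀ j, ∑ k, |f k j| ≤ 1) ∧
    v = ∑ k, ‖u (f k)‖ ^ q}
  have hSC : ∀ v ∈ S, v ≤ C ^ q := by
    rintro v ⟨n, f, hf, rfl⟩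
    have := H n (fun k => u (f k)) 1 zero_le_one (fun e he => by
      have : ∑ k, e k • u (f k) = ∑ j, (∑ k, e k * f k j) • x j := by
        simp only [u, Finset.smul_sum, Finset.sum_smul, smul_smul]
        exact Finset.sum_comm
      rw [this]
      refine hx _ fun j => (Finset.abs_sum_le_sum_abs _ _).trans (le_trans ?_ (hf j))
      refine Finset.sum_le_sum fun k _ => ?_
      rw [abs_mul]
      exact mul_le_of_le_one_left (abs_nonneg _) (he k))
    simpa using this
  have hSne : S.Nonempty := ⟨0, 0, fun k => k.elim0, by simp, by simp⟩
  have hSb : BddAbove S := ⟨C ^ q, hSC⟩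
  set M := sSup S with hM
  have hMC : M ≤ C ^ q := csSup_le hSne hSC
  set δ : ℝ := 1 / (Fintype.card ι + 1) with hδ
  have hδ0 : 0 < δ := by positivity
  obtain ⟨V, ⟨n, f, hf, hV⟩, hVM⟩ := exists_lt_of_lt_csSup hSne (sub_lt_self M hδ0)
  choose y hy1 hy2 using fun k => exists_dual_vector'' ℝ (u (f k))
  let w : Fin n → ℝ := fun k => ‖u (f k)‖ ^ (q - 1)
  let μ : ι → ℝ := fun j => ∑ k, w k * (f k j * y k (x j))
  have hpair : ∀ g : ι → ℝ, ∑ j, μ j * g j = ∑ k, w k * y k (u fun j => g j * f k j) := by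
    intro g
    simp only [μ, u, map_sum, map_smul, smul_eq_mul, Finset.mul_sum, Finset.sum_mul]
    rw [Finset.sum_comm]
    exact Finset.sum_congr rfl fun _ _ => Finset.sum_congr rfl fun _ _ => by ring
  have hkey : ∀ g : ι → ℝ, ∑ j, μ j * g j ≤
      (1 - 1 / q) * V + 1 / q * ∑ k, ‖u fun j => g j * f k j‖ ^ q := by
    intro g
    rw [hpair, hV, Finset.mul_sum, Finset.mul_sum, ← Finset.sum_add_distrib]
    refine Finset.sum_le_sum fun k _ => ?_
    set b := u fun j => g j * f k j
    have h1 : y k b ≤ ‖b‖ := (le_abs_self _).trans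
      (((y k).le_opNorm b).trans (mul_le_of_le_one_left (norm_nonneg _) (hy1 k)))
    refine (mul_le_mul_of_nonneg_left h1 (by positivity)).trans ?_
    have h1q : 1 / q ≤ 1 := by rw [div_le_one hq0]; linarith
    have := Real.geom_mean_le_arith_mean2_weighted (w₁ := 1 - 1 / q) (w₂ := 1 / q)
      (p₁ := ‖u (f k)‖ ^ q) (p₂ := ‖b‖ ^ q) (by linarith) (by positivity) (by positivity)
      (by positivity) (by ring)
    rwa [← Real.rpow_mul (norm_nonneg _), ← Real.rpow_mul (norm_nonneg _),
      mul_one_div_cancel hq0.ne', Real.rpow_one, mul_sub, mul_one,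
      mul_one_div_cancel hq0.ne'] at this
  have hμV : ∑ j, μ j = V := by
    have := hpair 1
    simp only [Pi.one_apply, mul_one, one_mul] at this
    rw [this, hV]
    refine Finset.sum_congr rfl fun k _ => ?_
    have : y k (u fun j => f k j) = ‖u (f k)‖ := hy2 k
    rw [this]
    rcases (norm_nonneg (u (f k))).eq_or_lt with h0 | h0
    · rw [← h0, mul_zero, Real.zero_rpow hq0.ne']
    · simp only [w]
      rw [← Real.rpow_add_one h0.ne', sub_add_cancel]
  have hVM' : V ≤ M := le_csSup hSb ⟨n, f, hf, hV⟩
  have htot : ∑ j, |μ j| ≤ M := by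
    let g : ι → ℝ := fun j => SignType.sign (μ j)
    have hg : ∀ j, |g j| ≤ 1 := by
      intro j
      simp only [g]
      rcases lt_trichotomy (μ j) 0 with h | h | h <;> simp [h]
    have h1 : ∑ k, ‖u fun j => g j * f k j‖ ^ q ≤ M := le_csSup hSb
      ⟨n, fun k j => g j * f k j, fun j => le_trans (Finset.sum_le_sum fun k _ => by
        rw [abs_mul]; exact mul_le_of_le_one_left (abs_nonneg _) (hg j)) (hf j), rfl⟩
    have h2 := hkey g
    have h3 : ∑ j, |μ j| = ∑ j, μ j * g j :=
      Finset.sum_congr rfl fun j _ => by simp only [g]; rw [self_mul_sign]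
    have h4 : 0 ≤ 1 / q := by positivity
    have h1q : 1 / q ≤ 1 := by rw [div_le_one hq0]; linarith
    rw [h3]
    nlinarith [mul_le_mul_of_nonneg_left h1 h4,
      mul_le_mul_of_nonneg_left hVM' (by linarith : 0 ≤ 1 - 1 / q)]
  refine ⟨fun j => (q * |μ j| + δ) / K, fun j => by positivity, ?_, ?_⟩
  · rw [← Finset.sum_div, div_le_one hK0, Finset.sum_add_distrib, ← Finset.mul_sum]
    have : ∑ _j : ι, δ ≤ 1 := by
      simp only [Finset.sum_const, Finset.card_univ, nsmul_eq_mul, hδ]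
      rw [mul_one_div, div_le_one (by positivity)]
      linarith
    have := mul_le_mul_of_nonneg_left (htot.trans hMC) hq0.le
    linarith
  · intro A φ hφ
    rw [← Finset.sum_div, mul_div_cancel₀ _ hK0.ne']
    rcases A.eq_empty_or_nonempty with rfl | hA
    · simp [Real.zero_rpow hq0.ne']
    let φA : ι → ℝ := fun j => if j ∈ A then φ j else 0
    let g : ι → ℝ := fun j => if j ∈ A then 0 else 1
    have hu : ∑ j ∈ A, φ j • x j = u φA := by
      simp [u, φA, ite_smul, Finset.sum_ite_mem]
    have h1 : ‖u φA‖ ^ q + ∑ k, ‖u fun j => g j * f k j‖ ^ q ≤ M := by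
      refine le_csSup hSb ⟨n + 1, Fin.cons φA (fun k j => g j * f k j), fun j => ?_, ?_⟩
      · rw [Fin.sum_univ_succ]
        simp only [Fin.cons_zero, Fin.cons_succ, φA, g]
        by_cases hj : j ∈ A
        · simpa [hj] using hφ j
        · simpa [hj] using hf j
      · rw [Fin.sum_univ_succ]
        simp only [Fin.cons_zero, Fin.cons_succ]
    have h2 := hkey g
    have h3 : V - ∑ j ∈ A, |μ j| ≤ ∑ j, μ j * g j := by
      have : ∑ j, μ j * g j = ∑ j, μ j - ∑ j ∈ A, μ j := by
        rw [eq_sub_iff_add_eq, ← Finset.sum_ite_mem_eq A μ, ← Finset.sum_add_distrib]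
        refine Finset.sum_congr rfl fun j _ => ?_
        simp only [g]
        split_ifs <;> simp
      rw [this, hμV]
      exact sub_le_sub_left (Finset.sum_le_sum fun j _ => le_abs_self _) _
    have h4 : δ ≤ ∑ _j ∈ A, δ := by
      obtain ⟨j, hj⟩ := hA
      exact Finset.single_le_sum (f := fun _ => δ) (fun _ _ => hδ0.le) hj
    rw [hu, Finset.sum_add_distrib, ← Finset.mul_sum]
    have h5 := mul_le_mul_of_nonneg_left (h3.trans h2) hq0.le
    have h6 : q * ((1 - 1 / q) * V + 1 / q * ∑ k, ‖u fun j => g j * f k j‖ ^ q)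
        = (q - 1) * V + ∑ k, ‖u fun j => g j * f k j‖ ^ q := by
      field_simp
    rw [h6] at h5
    nlinarith

/-- A Marcinkiewicz-type bound: a function in weak `L_{q*}` of a finite measure with weights `ν`
is in `L_r` for `r < q*`. -/
lemma exists_sum_rpow_le_of_weak {q r : ℝ} (hq : 1 < q) (hr : 1 < r) (hrq : r < q / (q - 1)) :
    ∃ K > 0, ∀ {ι : Type} [Fintype ι] (ν a : ι → ℝ), (∀ j, 0 < ν j) → (∑ j, ν j ≤ 1) →
      (∀ j, 0 ≤ a j) → (∀ A : Finset ι, (∑ j ∈ A, a j) ^ q ≤ ∑ j ∈ A, ν j) →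
      ∑ j, ν j * (a j / ν j) ^ r ≤ K := by
  set ρ : ℝ := 2 ^ (r - q / (q - 1)) with hρ
  have hρ0 : 0 < ρ := by positivity
  have hρ1 : ρ < 1 := Real.rpow_lt_one_of_one_lt_of_neg one_lt_two (by linarith)
  have hsum := summable_geometric_of_lt_one hρ0.le hρ1
  have hts : 0 ≤ ∑' n : ℕ, ρ ^ n := tsum_nonneg fun n => by positivity
  refine ⟨1 + 2 ^ r * ∑' n : ℕ, ρ ^ n, by positivity, ?_⟩
  intro ι _ ν a hν hν1 ha hA
  classical
  set g : ι → ℝ := fun j => a j / ν j with hg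
  have hg0 : ∀ j, 0 ≤ g j := fun j => div_nonneg (ha j) (hν j).le
  let A : ℕ → Finset ι := fun n => Finset.univ.filter fun j => (2 : ℝ) ^ n ≤ g j
  have hAn : ∀ n, ∑ j ∈ A n, ν j ≤ 2 ^ (-(n * (q / (q - 1)))) := by
    intro n
    set v := ∑ j ∈ A n, ν j with hv
    have hv0 : 0 ≤ v := Finset.sum_nonneg fun j _ => (hν j).le
    rcases hv0.eq_or_lt with h0 | h0
    · rw [← h0]; positivity
    have h1 : 2 ^ n * v ≤ ∑ j ∈ A n, a j := by
      rw [hv, Finset.mul_sum]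
      refine Finset.sum_le_sum fun j hj => ?_
      have : (2 : ℝ) ^ n ≤ a j / ν j := (Finset.mem_filter.1 hj).2
      rwa [le_div_iff₀ (hν j)] at this
    have h2 : (2 ^ n * v) ^ q ≤ v :=
      (Real.rpow_le_rpow (by positivity) h1 (by linarith)).trans (hA _)
    rw [Real.mul_rpow (by positivity) hv0, ← Real.rpow_natCast, ← Real.rpow_mul zero_le_two] at h2
    have h3 : v ^ q = v ^ (q - 1) * v := by
      rw [← Real.rpow_add_one h0.ne', sub_add_cancel]
    rw [h3, ← mul_assoc] at h2
    have h4 : 2 ^ (n * q) * v ^ (q - 1) ≤ 1 := by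
      by_contra! hcon
      nlinarith
    have h5 : v ^ (q - 1) ≤ 2 ^ (-(n * q)) := by
      rw [Real.rpow_neg zero_le_two, ← one_div, le_div_iff₀ (by positivity), mul_comm]
      exact h4
    have h6 := Real.rpow_le_rpow (by positivity) h5 (by
      have : 0 < q - 1 := by linarith
      positivity : 0 ≤ 1 / (q - 1))
    rw [← Real.rpow_mul hv0, mul_one_div_cancel (by linarith), Real.rpow_one,
      ← Real.rpow_mul zero_le_two] at h6
    refine h6.trans_eq ?_
    congr 1
    ring
  have hk : ∀ j, ∃ k : ℕ, 1 ≤ g j → (2 : ℝ) ^ k ≤ g j ∧ g j < 2 ^ (k + 1) := by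
    intro j
    by_cases h : 1 ≤ g j
    · obtain ⟨k, hk⟩ := exists_nat_pow_near h one_lt_two
      exact ⟨k, fun _ => hk⟩
    · exact ⟨0, fun h' => absurd h' h⟩
  choose k hk using hk
  let N := Finset.univ.sup k + 1
  have hpt : ∀ j, ν j * g j ^ r ≤ ν j + ∑ n ∈ Finset.range N,
      if j ∈ A n then (2 : ℝ) ^ ((n + 1 : ℝ) * r) * ν j else 0 := by
    intro j
    have hnn : ∀ n ∈ Finset.range N,
        0 ≤ if j ∈ A n then (2 : ℝ) ^ ((n + 1 : ℝ) * r) * ν j else 0 := by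
      intro n _
      have := (hν j).le
      split_ifs <;> positivity
    by_cases h : 1 ≤ g j
    · obtain ⟨h1, h2⟩ := hk j h
      have hmem : k j ∈ Finset.range N :=
        Finset.mem_range.2 (Nat.lt_succ_of_le (Finset.le_sup (f := k) (Finset.mem_univ j)))
      have h3 := Finset.single_le_sum hnn hmem
      rw [if_pos (show j ∈ A (k j) from Finset.mem_filter.2 ⟨Finset.mem_univ _, h1⟩)] at h3
      have h4 : g j ^ r ≤ (2 : ℝ) ^ ((k j + 1 : ℝ) * r) := by
        rw [Real.rpow_mul zero_le_two]
        refine Real.rpow_le_rpow (hg0 j) ?_ (by linarith)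
        exact_mod_cast h2.le
      nlinarith [hν j, mul_le_mul_of_nonneg_left h4 (hν j).le]
    · have h1 : g j ^ r ≤ 1 := Real.rpow_le_one (hg0 j) (by linarith) (by linarith)
      have h2 := Finset.sum_nonneg hnn
      nlinarith [mul_le_mul_of_nonneg_left h1 (hν j).le]
  calc ∑ j, ν j * g j ^ r
      ≤ ∑ j, (ν j + ∑ n ∈ Finset.range N,
        if j ∈ A n then (2 : ℝ) ^ ((n + 1 : ℝ) * r) * ν j else 0) :=
        Finset.sum_le_sum fun j _ => hpt j
    _ = ∑ j, ν j + ∑ n ∈ Finset.range N, 2 ^ ((n + 1 : ℝ) * r) * ∑ j ∈ A n, ν j := by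
        rw [Finset.sum_add_distrib, Finset.sum_comm]
        congr 1
        refine Finset.sum_congr rfl fun n _ => ?_
        rw [Finset.mul_sum, Finset.sum_ite_mem, Finset.univ_inter]
    _ ≤ 1 + ∑ n ∈ Finset.range N, 2 ^ r * ρ ^ n := by
        refine add_le_add hν1 (Finset.sum_le_sum fun n _ => ?_)
        refine (mul_le_mul_of_nonneg_left (hAn n) (by positivity)).trans_eq ?_
        rw [hρ, ← Real.rpow_natCast, ← Real.rpow_mul zero_le_two, ← Real.rpow_add two_pos,
          ← Real.rpow_add two_pos]
        congr 1
        ring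
    _ ≤ 1 + 2 ^ r * ∑' n : ℕ, ρ ^ n := by
        rw [← Finset.mul_sum]
        gcongr
        exact hsum.sum_le_tsum _ fun n _ => by positivity

/-- In a space of cotype `q`, for `1 < r < q*` a weakly `1`-summable finite family is the product of
a scalar family in the unit ball of `ℓ_{r*}` and a weakly `r`-summable family. -/
lemma HasCotype.exists_factorization {q r : ℝ} {E : Type*} [NormedAddCommGroup E]
    [NormedSpace ℝ E] (h : HasCotype q E) (hr : 1 < r) (hrq : r < q / (q - 1)) :
    ∃ K > 0, ∀ {ι : Type} [Fintype ι] (x : ι → E) (R : ℝ), 0 ≤ R →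
      (∀ φ : E →L[ℝ] ℝ, ‖φ‖ ≤ 1 → ∑ j, |φ (x j)| ≤ R) →
      ∃ (y : ι → E) (l : ι → ℝ), (∀ j, x j = l j • y j) ∧ (∀ j, 0 ≤ l j) ∧
        ∑ j, l j ^ (r / (r - 1)) ≤ 1 ∧
        ∀ φ : E →L[ℝ] ℝ, ‖φ‖ ≤ 1 → ∑ j, |φ (y j)| ^ r ≤ (K * R) ^ r := by
  have hq : 2 ≤ q := h.1
  have hr0 : 0 < r := by linarith
  have hr1 : 0 < r - 1 := by linarith
  obtain ⟨L, hL, HL⟩ := h.exists_dominating_weight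
  obtain ⟨K, hK, HK⟩ := exists_sum_rpow_le_of_weak (by linarith : 1 < q) hr hrq
  refine ⟨L * K ^ (1 / r), by positivity, ?_⟩
  intro ι _ x R hR hx
  classical
  rcases hR.eq_or_lt with rfl | hR
  · have hx0 : ∀ j, x j = 0 := by
      intro j
      by_contra hne
      obtain ⟨φ, hφ, hφx⟩ := exists_dual_vector'' ℝ (x j)
      have h1 := (Finset.single_le_sum (f := fun j => |φ (x j)|) (fun _ _ => abs_nonneg _)
        (Finset.mem_univ j)).trans (hx φ hφ)
      have h2 : φ (x j) = ‖x j‖ := hφx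
      rw [h2, abs_of_nonneg (norm_nonneg _)] at h1
      exact hne (norm_le_zero_iff.1 h1)
    have hne : r / (r - 1) ≠ 0 := by positivity
    exact ⟨0, 0, by simp [hx0], by simp, by simp [Real.zero_rpow hne],
      by simp [Real.zero_rpow hr0.ne']⟩
  have hnorm : ∀ f : ι → ℝ, (∀ j, |f j| ≤ 1) → ‖∑ j, f j • (R⁻¹ • x j)‖ ≤ 1 := by
    intro f hf
    obtain ⟨φ, hφ, hφx⟩ := exists_dual_vector'' ℝ (∑ j, f j • (R⁻¹ • x j))
    have h2 : φ (∑ j, f j • (R⁻¹ • x j)) = ‖∑ j, f j • (R⁻¹ • x j)‖ := hφx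
    rw [← h2, map_sum]
    calc ∑ j, φ (f j • (R⁻¹ • x j)) ≤ ∑ j, R⁻¹ * |φ (x j)| := by
          refine Finset.sum_le_sum fun j _ => (le_abs_self _).trans ?_
          rw [map_smul, map_smul, smul_eq_mul, smul_eq_mul, abs_mul, abs_mul,
            abs_of_pos (inv_pos.2 hR)]
          exact mul_le_of_le_one_left (by positivity) (hf j)
      _ ≤ R⁻¹ * R := by
          rw [← Finset.mul_sum]
          exact mul_le_mul_of_nonneg_left (hx φ hφ) (inv_pos.2 hR).le
      _ = 1 := inv_mul_cancel₀ hR.ne'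
  obtain ⟨ν, hν, hν1, hνA⟩ := HL (fun j => R⁻¹ • x j) hnorm
  have hl : ∀ j, 0 < ν j ^ ((r - 1) / r) := fun j => Real.rpow_pos_of_pos (hν j) _
  refine ⟨fun j => (ν j ^ ((r - 1) / r))⁻¹ • x j, fun j => ν j ^ ((r - 1) / r), fun j => ?_,
    fun j => (hl j).le, ?_, fun φ hφ => ?_⟩
  · rw [smul_inv_smul₀ (hl j).ne']
  · refine le_of_eq_of_le (Finset.sum_congr rfl fun j _ => ?_) hν1
    rw [← Real.rpow_mul (hν j).le, div_mul_div_cancel₀ hr0.ne', div_self hr1.ne', Real.rpow_one]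
  · have hLR : 0 < L * R := by positivity
    have h1 := HK ν (fun j => |φ (x j)| / (L * R)) hν hν1 (fun j => by positivity) (fun A => by
      have h2 := hνA A (fun j => SignType.sign (φ (x j))) (fun j => by
        rcases lt_trichotomy (φ (x j)) 0 with h | h | h <;> simp [h])
      have h3 : R⁻¹ * ∑ j ∈ A, |φ (x j)| ≤
          ‖∑ j ∈ A, ((SignType.sign (φ (x j)) : SignType) : ℝ) • R⁻¹ • x j‖ := by
        have h4 := ((le_abs_self _).trans (φ.le_opNorm
          (∑ j ∈ A, ((SignType.sign (φ (x j)) : SignType) : ℝ) • R⁻¹ • x j))).trans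
          (mul_le_of_le_one_left (norm_nonneg _) hφ)
        refine le_of_eq_of_le ?_ h4
        rw [map_sum, Finset.mul_sum]
        refine Finset.sum_congr rfl fun j _ => ?_
        rw [map_smul, map_smul, smul_eq_mul, smul_eq_mul, ← sign_mul_self (φ (x j))]
        ring
      have h5 := (Real.rpow_le_rpow (by positivity) h3 (by linarith : 0 ≤ q)).trans h2
      rw [← Finset.sum_div]
      have h6 : (∑ j ∈ A, |φ (x j)|) / (L * R) = (R⁻¹ * ∑ j ∈ A, |φ (x j)|) / L := by
        field_simp
      rw [h6, Real.div_rpow (by positivity) hL.le, div_le_iff₀ (by positivity),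
        mul_comm (Finset.sum A ν)]
      exact h5)
    have h7 : (L * K ^ (1 / r) * R) ^ r = (L * R) ^ r * K := by
      rw [mul_right_comm, Real.mul_rpow hLR.le (by positivity), ← Real.rpow_mul hK.le,
        one_div_mul_cancel hr0.ne', Real.rpow_one]
    rw [h7]
    refine le_trans (le_of_eq ?_) (mul_le_mul_of_nonneg_left h1 (by positivity))
    rw [Finset.mul_sum]
    refine Finset.sum_congr rfl fun j _ => ?_
    have h8 : ((ν j ^ ((r - 1) / r))⁻¹) ^ r = ν j / ν j ^ r := by
      rw [Real.inv_rpow (hl j).le, ← Real.rpow_mul (hν j).le, div_mul_cancel₀ _ hr0.ne',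
        Real.rpow_sub_one (hν j).ne', inv_div]
    rw [map_smul, smul_eq_mul, abs_mul, abs_of_pos (inv_pos.2 (hl j)),
      Real.mul_rpow (inv_pos.2 (hl j)).le (abs_nonneg _), h8,
      Real.div_rpow (by positivity) (hν j).le, Real.div_rpow (abs_nonneg _) hLR.le]
    have : (L * R) ^ r ≠ 0 := by positivity
    field_simp

lemma WeaklySummable.sum_le_weakNorm {E : Type*} [NormedAddCommGroup E] [NormedSpace ℝ E]
    {x : ℕ → E} (hx : WeaklySummable 1 x) {φ : E →L[ℝ] ℝ} (hφ : ‖φ‖ ≤ 1) (S : Finset ℕ) :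
    ∑ j ∈ S, |φ (x j)| ≤ weakNorm 1 x := by
  have hx' : ∀ φ : E →L[ℝ] ℝ, Summable fun j => |φ (x j)| := fun φ => by simpa using hx φ
  let g : Finset ℕ × {e : ℕ → ℝ // ∀ j, |e j| ≤ 1} → (E →L[ℝ] ℝ) →L[ℝ] ℝ := fun i =>
    ∑ j ∈ i.1, i.2.1 j • ContinuousLinearMap.apply ℝ ℝ (x j)
  have hg : ∀ i φ, g i φ = ∑ j ∈ i.1, i.2.1 j * φ (x j) := fun i φ => by
    simp [g]
  obtain ⟨B, hB⟩ := banach_steinhaus (g := g) fun φ => ⟨∑' j, |φ (x j)|, fun i => by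
    rw [hg]
    refine (Finset.abs_sum_le_sum_abs _ _).trans (le_trans (Finset.sum_le_sum fun j _ => ?_)
      ((hx' φ).sum_le_tsum i.1 fun _ _ => abs_nonneg _))
    rw [abs_mul]
    exact mul_le_of_le_one_left (abs_nonneg _) (i.2.2 j)⟩
  have hbdd : BddAbove (Set.range fun φ : {φ : E →L[ℝ] ℝ // ‖φ‖ ≤ 1} =>
      (∑' j, |φ.1 (x j)| ^ (1 : ℝ)) ^ (1 / (1 : ℝ))) := by
    refine ⟨B, ?_⟩
    rintro _ ⟨⟨φ, hφ⟩, rfl⟩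
    simp only [Real.rpow_one, div_one]
    refine Real.tsum_le_of_sum_le (fun _ => abs_nonneg _) fun S => ?_
    let i : Finset ℕ × {e : ℕ → ℝ // ∀ j, |e j| ≤ 1} :=
      (S, ⟨fun j => SignType.sign (φ (x j)), fun j => by
        rcases lt_trichotomy (φ (x j)) 0 with h | h | h <;> simp [h]⟩)
    have h1 : ∑ j ∈ S, |φ (x j)| = g i φ := by
      rw [hg]
      exact Finset.sum_congr rfl fun j _ => (sign_mul_self _).symm
    rw [h1]
    have hB0 : 0 ≤ B := (norm_nonneg _).trans (hB i)
    calc g i φ ≤ ‖g i φ‖ := le_abs_self _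
      _ ≤ B * ‖φ‖ := (g i).le_of_opNorm_le (hB i) φ
      _ ≤ B := mul_le_of_le_one_right hB0 hφ
  have h1 := le_ciSup hbdd ⟨φ, hφ⟩
  simp only [Real.rpow_one, div_one] at h1
  refine ((hx' φ).sum_le_tsum S fun _ _ => abs_nonneg _).trans (h1.trans_eq ?_)
  simp [weakNorm]

lemma weakNorm_nonneg {E : Type*} [NormedAddCommGroup E] [NormedSpace ℝ E] (p : ℝ) (x : ℕ → E) :
    0 ≤ weakNorm p x :=
  Real.iSup_nonneg fun _ => by positivity

/-- Hölder's inequality `ℓ_p · ℓ_a ⊆ ℓ_s` for `1 / s ≤ 1 / p + 1 / a`. -/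
lemma sum_mul_rpow_le_of_holder {κ : Type*} {p a s D : ℝ} (hp : 0 < p) (ha : 0 < a) (hs : 0 < s)
    (hpas : 1 / s ≤ 1 / p + 1 / a) (hD : 0 ≤ D) (S : Finset κ) (l b : κ → ℝ) (hl : ∀ j, 0 ≤ l j)
    (hb : ∀ j, 0 ≤ b j) (hlS : ∑ j ∈ S, l j ^ p ≤ 1) (hbS : ∑ j ∈ S, b j ^ a ≤ D ^ a) :
    ∑ j ∈ S, (l j * b j) ^ s ≤ D ^ s := by
  have hla : ∀ j ∈ S, l j ≤ 1 := fun j hj => by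
    have := (Finset.single_le_sum (fun j _ => Real.rpow_nonneg (hl j) p) hj).trans hlS
    rw [← Real.one_rpow p] at this
    exact (Real.rpow_le_rpow_iff (hl j) zero_le_one hp).1 this
  have hba : ∀ j ∈ S, b j ≤ D := fun j hj => by
    have := (Finset.single_le_sum (fun j _ => Real.rpow_nonneg (hb j) a) hj).trans hbS
    exact (Real.rpow_le_rpow_iff (hb j) hD ha).1 this
  rcases hD.eq_or_lt with rfl | hD
  · refine le_of_eq ?_
    rw [Real.zero_rpow hs.ne']
    refine Finset.sum_eq_zero fun j hj => ?_
    rw [le_antisymm (hba j hj) (hb j), mul_zero, Real.zero_rpow hs.ne']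
  set t : ℝ := 1 / (1 / p + 1 / a) with ht
  have ht0 : 0 < t := by positivity
  have hts : t ≤ s := by
    rw [ht, one_div_le (by positivity) hs]
    exact hpas
  have hw : t / p + t / a = 1 := by
    rw [ht]
    field_simp
  have hpt : ∀ j ∈ S, (l j * b j) ^ s ≤ D ^ s * (t / p * l j ^ p + t / a * (b j ^ a / D ^ a)) := by
    intro j hj
    have hbD : 0 ≤ b j / D := div_nonneg (hb j) hD.le
    have h0 : 0 ≤ l j * (b j / D) := mul_nonneg (hl j) hbD
    have h1 : l j * (b j / D) ≤ 1 :=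
      mul_le_one₀ (hla j hj) hbD ((div_le_one hD).2 (hba j hj))
    have h2 : l j * b j = D * (l j * (b j / D)) := by field_simp
    rw [h2, Real.mul_rpow hD.le h0]
    refine mul_le_mul_of_nonneg_left ?_ (by positivity)
    have h3 : (l j * (b j / D)) ^ s ≤ (l j * (b j / D)) ^ t :=
      Real.rpow_le_rpow_of_exponent_ge_of_imp h0 h1 hts fun _ h => absurd h hs.ne'
    refine h3.trans ?_
    have h4 := Real.geom_mean_le_arith_mean2_weighted (w₁ := t / p) (w₂ := t / a)
      (p₁ := l j ^ p) (p₂ := (b j / D) ^ a) (by positivity) (by positivity)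
      (Real.rpow_nonneg (hl j) _) (Real.rpow_nonneg hbD _) hw
    rwa [← Real.rpow_mul (hl j), ← Real.rpow_mul hbD, mul_div_cancel₀ _ hp.ne',
      mul_div_cancel₀ _ ha.ne', ← Real.mul_rpow (hl j) hbD, Real.div_rpow (hb j) hD.le] at h4
  refine (Finset.sum_le_sum hpt).trans ?_
  rw [← Finset.mul_sum, Finset.sum_add_distrib, ← Finset.mul_sum, ← Finset.mul_sum,
    ← Finset.sum_div]
  refine mul_le_of_le_one_right (by positivity) ?_
  have h5 : (∑ j ∈ S, b j ^ a) / D ^ a ≤ 1 := (div_le_one (by positivity)).2 hbS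
  have h6 := mul_le_mul_of_nonneg_left hlS (by positivity : 0 ≤ t / p)
  have h7 := mul_le_mul_of_nonneg_left h5 (by positivity : 0 ≤ t / a)
  linarith

/-- if each `E_i` has cotype `q_i > 2`, `q = max q_i`, `1 < r < q*`,
`r ≤ a < ∞`, `1 ≤ s < ∞` and `1/r − 1/a ≤ 1 − 1/s`, then every multiple `(a,r)`-summing
`m`-linear operator is multiple `(s,1)`-summing. -/
theorem stmt6 {m : ℕ} (hm : 1 ≤ m) (E : Fin m → Type*) [∀ i, NormedAddCommGroup (E i)]
    [∀ i, NormedSpace ℝ (E i)] [∀ i, CompleteSpace (E i)]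
    (F : Type*) [NormedAddCommGroup F] [NormedSpace ℝ F] [CompleteSpace F]
    (hE : ∀ i, ¬ FiniteDimensional ℝ (E i)) (hF : ¬ FiniteDimensional ℝ F)
    (qi : Fin m → ℝ) (hqi : ∀ i, 2 < qi i ∧ HasCotype (qi i) (E i))
    (q : ℝ) (hq : IsGreatest (Set.range qi) q)
    (r a s : ℝ) (hr1 : 1 < r) (hr2 : r < q / (q - 1)) (hra : r ≤ a) (hs : 1 ≤ s)
    (h : 1 / r - 1 / a ≤ 1 - 1 / s)
    (T : ContinuousMultilinearMap ℝ E F) (hT : MultipleSumming a r T) :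
    MultipleSumming s 1 T := by
  have hr0 : 0 < r := by linarith
  have hr1' : 0 < r - 1 := by linarith
  have ha0 : 0 < a := by linarith
  have hs0 : 0 < s := by linarith
  have hcot : ∀ i, r < qi i / (qi i - 1) := by
    intro i
    have h1 : qi i ≤ q := hq.2 ⟨i, rfl⟩
    have h2 := (hqi i).1
    rw [lt_div_iff₀ (by linarith)] at hr2 ⊢
    nlinarith
  choose K hK HK using fun i => (hqi i).2.exists_factorization hr1 (hcot i)
  obtain ⟨C, hC, HC⟩ := hT
  refine ⟨C * ∏ i, K i, mul_pos hC (Finset.prod_pos fun i _ => hK i), fun x hx => ?_⟩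
  set R : Fin m → ℝ := fun i => weakNorm 1 (x i) with hR
  have hR0 : ∀ i, 0 ≤ R i := fun i => weakNorm_nonneg _ _
  set D : ℝ := C * ∏ i, (K i * R i) with hD
  have hKR : ∀ i, 0 ≤ K i * R i := fun i => mul_nonneg (hK i).le (hR0 i)
  have hD0 : 0 ≤ D := mul_nonneg hC.le (Finset.prod_nonneg fun i _ => hKR i)
  have hmain : ∀ J : Finset (Fin m → ℕ), ∑ j ∈ J, ‖T (fun i => x i (j i))‖ ^ s ≤ D ^ s := by
    intro J
    obtain ⟨S, hS⟩ : ∃ S : Finset ℕ, J ⊆ Fintype.piFinset fun _ => S := by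
      refine ⟨J.biUnion fun j => Finset.univ.image j, fun j hj => Fintype.mem_piFinset.2 fun i => ?_⟩
      exact Finset.mem_biUnion.2 ⟨j, hj, Finset.mem_image_of_mem _ (Finset.mem_univ i)⟩
    have hfac := fun i => HK i (ι := S) (fun j => x i j) (R i) (hR0 i) fun φ hφ => by
      rw [Finset.sum_coe_sort S fun j => |φ (x i j)|]
      exact (hx i).sum_le_weakNorm hφ S
    choose y l hxy hl hlsum hy using hfac
    let Y : (i : Fin m) → ℕ → E i := fun i j => if hj : j ∈ S then y i ⟨j, hj⟩ else 0
    let Λ : Fin m → ℕ → ℝ := fun i j => if hj : j ∈ S then l i ⟨j, hj⟩ else 0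
    have hΛ0 : ∀ i j, 0 ≤ Λ i j := fun i j => by
      simp only [Λ]
      split_ifs
      exacts [hl _ _, le_rfl]
    have hxY : ∀ i, ∀ j ∈ S, x i j = Λ i j • Y i j := fun i j hj => by
      simp only [Λ, Y, dif_pos hj]
      exact hxy i ⟨j, hj⟩
    have hYz : ∀ i, ∀ j ∉ S, Y i j = 0 := fun i j hj => dif_neg hj
    have hYS : ∀ i (φ : E i →L[ℝ] ℝ), ∀ j ∉ S, |φ (Y i j)| ^ r = 0 := fun i φ j hj => by
      rw [hYz i j hj, map_zero, abs_zero, Real.zero_rpow hr0.ne']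
    have hYw : ∀ i, WeaklySummable r (Y i) := fun i φ =>
      summable_of_ne_finset_zero (s := S) (hYS i φ)
    have hYn : ∀ i, weakNorm r (Y i) ≤ K i * R i := by
      intro i
      refine Real.iSup_le (fun φ => ?_) (hKR i)
      rw [tsum_eq_sum (hYS i φ.1), ← Finset.sum_coe_sort S]
      have h1 : ∑ j : S, |φ.1 (Y i j)| ^ r ≤ (K i * R i) ^ r := by
        refine le_of_eq_of_le (Finset.sum_congr rfl fun j _ => ?_) (hy i φ.1 φ.2)
        simp only [Y, dif_pos j.2]
      refine (Real.rpow_le_rpow (by positivity) h1 (by positivity)).trans_eq ?_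
      rw [← Real.rpow_mul (hKR i), mul_one_div_cancel hr0.ne', Real.rpow_one]
    obtain ⟨hsum, hle⟩ := HC Y hYw
    have hle' : (∑' j : Fin m → ℕ, ‖T (fun i => Y i (j i))‖ ^ a) ^ (1 / a) ≤ D :=
      hle.trans (mul_le_mul_of_nonneg_left
        (Finset.prod_le_prod (fun i _ => weakNorm_nonneg _ _) fun i _ => hYn i) hC.le)
    have hb : ∑ j ∈ Fintype.piFinset fun _ => S, ‖T (fun i => Y i (j i))‖ ^ a ≤ D ^ a := by
      refine (hsum.sum_le_tsum _ fun _ _ => by positivity).trans ?_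
      have ht : 0 ≤ ∑' j : Fin m → ℕ, ‖T (fun i => Y i (j i))‖ ^ a :=
        tsum_nonneg fun _ => by positivity
      have h1 := Real.rpow_le_rpow (by positivity) hle' ha0.le
      rwa [← Real.rpow_mul ht, one_div_mul_cancel ha0.ne', Real.rpow_one] at h1
    have hΛ : ∑ j ∈ Fintype.piFinset fun _ => S, (∏ i, Λ i (j i)) ^ (r / (r - 1)) ≤ 1 := by
      simp_rw [← Real.finsetProd_rpow _ _ fun i _ => hΛ0 i _]
      rw [← Finset.prod_univ_sum (fun _ => S) fun i j => Λ i j ^ (r / (r - 1))]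
      refine Finset.prod_le_one (fun i _ => Finset.sum_nonneg fun j _ =>
        Real.rpow_nonneg (hΛ0 i j) _) fun i _ => ?_
      rw [← Finset.sum_coe_sort S]
      refine le_of_eq_of_le (Finset.sum_congr rfl fun j _ => ?_) (hlsum i)
      simp only [Λ, dif_pos j.2]
    refine (Finset.sum_le_sum_of_subset_of_nonneg hS fun _ _ _ => by positivity).trans ?_
    refine le_of_eq_of_le (Finset.sum_congr rfl fun j hj => ?_)
      (sum_mul_rpow_le_of_holder (p := r / (r - 1)) (by positivity) ha0 hs0 ?_ hD0
        (Fintype.piFinset fun _ => S) (fun j => ∏ i, Λ i (j i))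
        (fun j => ‖T (fun i => Y i (j i))‖) (fun j => Finset.prod_nonneg fun i _ => hΛ0 i _)
        (fun j => norm_nonneg _) hΛ hb)
    · have h1 : (fun i => x i (j i)) = fun i => Λ i (j i) • Y i (j i) :=
        funext fun i => hxY i _ (Fintype.mem_piFinset.1 hj i)
      rw [h1, T.map_smul_univ, norm_smul,
        Real.norm_of_nonneg (Finset.prod_nonneg fun i _ => hΛ0 i _)]
    · have h1 : 1 / (r / (r - 1)) = 1 - 1 / r := by field_simp
      rw [h1]
      linarith
  refine ⟨summable_of_sum_le (fun _ => by positivity) hmain, ?_⟩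
  have h1 := Real.tsum_le_of_sum_le (fun _ => by positivity) hmain
  have h2 := Real.rpow_le_rpow (tsum_nonneg fun _ => by positivity) h1
    (by positivity : 0 ≤ 1 / s)
  rw [← Real.rpow_mul hD0, mul_one_div_cancel hs0.ne', Real.rpow_one] at h2
  refine h2.trans_eq ?_
  rw [hD, Finset.prod_mul_distrib, mul_assoc]

end
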